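/- arXiv:2410.09531 — 3 statements merged into one kernel-verified Lean document; each statement's English description precedes it below -/
import Mathlib

section
/- (Proposition 3, fusion of consecutive truncation and extension.) For natural numbers l₁, l₂, l₃ with 0 < l₂ < l₁ ≤ l₃ and any integer x with -2^(l₁-1) ≤ x < 2^(l₁-1), the image in ZMod (2^(l₃)) of Int.bmod (⌊x / 2^(l₂)⌋) (2^(l₁)) equals the image in ZMod (2^(l₃)) of Int.bmod (⌊x / 2^(l₂)⌋) (2^(l₁-l₂)), and both equal the image in ZMod (2^(l₃)) of ⌊x / 2^(l₂)⌋. In other words, Π_Ext^{l₁,l₃} ∘ Π_Trunc^{l₁,l₂} = Π_Ext^{l₁-l₂,l₃} ∘ Π_TR^{l₁,l₂}. -/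
/-- A signed value of at most `l` bits is fixed by balanced reduction modulo `2 ^ l`. -/
theorem Int.bmod_two_pow_eq_self {k l : ℕ} (hkl : k < l) {y : ℤ}
    (hle : -2 ^ k ≤ y) (hlt : y < 2 ^ k) : Int.bmod y (2 ^ l) = y := by
  have h : (2 : ℤ) ^ (k + 1) ≤ 2 ^ l := pow_le_pow_right₀ (by norm_num) hkl
  rw [pow_succ] at h
  apply Int.bmod_eq_of_le_mul_two <;> push_cast <;> linarith

/-- Proposition 3: `Π_Ext^{l₁,l₃} ∘ Π_Trunc^{l₁,l₂} = Π_Ext^{l₁-l₂,l₃} ∘ Π_TR^{l₁,l₂}`.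
For `0 < l₂ < l₁ ≤ l₃` and an `l₁`-bit signed value `x`, the image in
`ZMod (2^l₃)` of `Int.bmod (⌊x / 2^l₂⌋) (2^l₁)` equals that of
`Int.bmod (⌊x / 2^l₂⌋) (2^(l₁-l₂))`, and both equal the image of `⌊x / 2^l₂⌋`. -/
theorem trunc_ext_fusion (l₁ l₂ l₃ : ℕ) (hl₂ : 0 < l₂) (hlt : l₂ < l₁) (hl₃ : l₁ ≤ l₃)
    (x : ℤ) (hx₁ : -2 ^ (l₁ - 1) ≤ x) (hx₂ : x < 2 ^ (l₁ - 1)) :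
    ((Int.bmod (x / 2 ^ l₂) (2 ^ l₁) : ℤ) : ZMod (2 ^ l₃)) =
      ((Int.bmod (x / 2 ^ l₂) (2 ^ (l₁ - l₂)) : ℤ) : ZMod (2 ^ l₃)) ∧
    ((Int.bmod (x / 2 ^ l₂) (2 ^ (l₁ - l₂)) : ℤ) : ZMod (2 ^ l₃)) =
      ((x / 2 ^ l₂ : ℤ) : ZMod (2 ^ l₃)) := by
  obtain ⟨k, rfl⟩ : ∃ k, l₁ = k + l₂ + 1 := ⟨l₁ - l₂ - 1, by omega⟩
  rw [Nat.add_sub_cancel, pow_add] at hx₁ hx₂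
  have hpos : (0 : ℤ) < 2 ^ l₂ := by positivity
  have hle : -2 ^ k ≤ x / 2 ^ l₂ := (Int.le_ediv_iff_mul_le hpos).2 (by linarith)
  have hlt' : x / 2 ^ l₂ < 2 ^ k := (Int.ediv_lt_iff_lt_mul hpos).2 hx₂
  rw [Int.bmod_two_pow_eq_self (by omega) hle hlt', Int.bmod_two_pow_eq_self (by omega) hle hlt']
  exact ⟨rfl, rfl⟩
end

section
/- (Correctness of the OT-based matrix multiplication with activation-bit decomposition.) Let n, m, d₁, d₂, d₃ be natural numbers, let W : Fin d₁ → Fin d₂ → ZMod (2^n), and let x : Fin d₂ → Fin d₃ → ℕ be a matrix with x i j < 2^m for all i, j. Then for all k : Fin d₁ and j : Fin d₃, ∑_{i : Fin d₂} W k i * (x i j : ZMod (2^n)) = ∑_{i : Fin d₂} ∑_{b < m} (if Nat.testBit (x i j) b then (2^b : ZMod (2^n)) * W k i else 0). -/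
theorem Nat.sum_range_testBit_two_pow (w m : ℕ) :
    ∑ b ∈ Finset.range m, (if Nat.testBit w b then 2 ^ b else 0) = w % 2 ^ m := by
  induction m with
  | zero => simp [Nat.mod_one]
  | succ m ih =>
    rw [Finset.sum_range_succ, ih, Nat.mod_pow_succ, Nat.testBit_eq_decide_div_mod_eq]
    rcases Nat.mod_two_eq_zero_or_one (w / 2 ^ m) with h | h <;> simp [h]

/-- Correctness of the OT-based matrix multiplication with activation-bit
decomposition: each entry of the product over `ZMod (2^n)` equals the sum over
the bits of the `m`-bit activation representatives of the obliviously selected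
shifted weights. -/
theorem ot_matmul_activation_bits (n m d₁ d₂ d₃ : ℕ)
    (W : Fin d₁ → Fin d₂ → ZMod (2 ^ n))
    (x : Fin d₂ → Fin d₃ → ℕ) (hx : ∀ i j, x i j < 2 ^ m) :
    ∀ (k : Fin d₁) (j : Fin d₃),
      ∑ i : Fin d₂, W k i * (x i j : ZMod (2 ^ n)) =
        ∑ i : Fin d₂, ∑ b ∈ Finset.range m,
          (if Nat.testBit (x i j) b then (2 ^ b : ZMod (2 ^ n)) * W k i else 0) := by
  intro k j
  refine Finset.sum_congr rfl fun i _ => ?_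
  have h := Nat.sum_range_testBit_two_pow (x i j) m
  rw [Nat.mod_eq_of_lt (hx i j)] at h
  conv_lhs => rw [← h]
  push_cast
  rw [Finset.mul_sum]
  refine Finset.sum_congr rfl fun b _ => ?_
  split_ifs <;> simp [mul_comm]
end

section
/- (Faithful representation of the accumulation.) Let l₁, l₂, d₂ be natural numbers with l₁ ≥ 1, l₂ ≥ 1, d₂ ≥ 1, and let e = Nat.clog 2 d₂. Let w, x : Fin d₂ → ℤ satisfy |w j| < 2^(l₁-1) and |x j| < 2^(l₂-1) for all j. Then Int.bmod (∑_{j : Fin d₂} w j * x j) (2^(l₁+l₂+e)) = ∑_{j : Fin d₂} w j * x j; that is, the exact integer inner product is recovered from its residue modulo 2^(l₁+l₂+e). -/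
/-- An integer inner product of length `n` whose entries are bounded by `A` and `B` in absolute
value is bounded by `n * (A * B)`. -/
theorem abs_sum_mul_le_card_mul {n : ℕ} {w x : Fin n → ℤ} {A B : ℤ}
    (hw : ∀ j, |w j| ≤ A) (hx : ∀ j, |x j| ≤ B) :
    |∑ j, w j * x j| ≤ n * (A * B) := by
  calc |∑ j, w j * x j| ≤ ∑ j, |w j * x j| := Finset.abs_sum_le_sum_abs _ _
    _ ≤ ∑ _j : Fin n, A * B := Finset.sum_le_sum fun j _ => by
        rw [abs_mul]
        exact mul_le_mul (hw j) (hx j) (abs_nonneg _) ((abs_nonneg _).trans (hw j))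
    _ = n * (A * B) := by simp


/-- Faithful representation of the accumulation: the exact integer inner
product of `d₂` products of an `l₁`-bit signed weight and an `l₂`-bit signed
activation is recovered from its balanced residue modulo `2^(l₁+l₂+e)`,
where `e = ⌈log₂ d₂⌉`. -/
theorem conv_accumulation_bmod (l₁ l₂ d₂ : ℕ) (hl₁ : 1 ≤ l₁) (hl₂ : 1 ≤ l₂)
    (hd₂ : 1 ≤ d₂) (e : ℕ) (he : e = Nat.clog 2 d₂)
    (w x : Fin d₂ → ℤ)
    (hw : ∀ j, |w j| < 2 ^ (l₁ - 1)) (hx : ∀ j, |x j| < 2 ^ (l₂ - 1)) :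
    Int.bmod (∑ j : Fin d₂, w j * x j) (2 ^ (l₁ + l₂ + e)) =
      ∑ j : Fin d₂, w j * x j := by
  subst he
  obtain ⟨a, rfl⟩ := Nat.exists_eq_add_of_le' hl₁
  obtain ⟨b, rfl⟩ := Nat.exists_eq_add_of_le' hl₂
  simp only [Nat.add_sub_cancel] at hw hx
  have hd : (d₂ : ℤ) ≤ 2 ^ Nat.clog 2 d₂ := mod_cast Nat.le_pow_clog one_lt_two d₂
  have hS : |∑ j, w j * x j| ≤ 2 ^ Nat.clog 2 d₂ * (2 ^ a * 2 ^ b) :=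
    (abs_sum_mul_le_card_mul (fun j => (hw j).le) fun j => (hx j).le).trans
      (mul_le_mul_of_nonneg_right hd (by positivity))
  have hP : (0 : ℤ) < 2 ^ Nat.clog 2 d₂ * (2 ^ a * 2 ^ b) := by positivity
  have hM : ((2 ^ (a + 1 + (b + 1) + Nat.clog 2 d₂) : ℕ) : ℤ) =
      4 * (2 ^ Nat.clog 2 d₂ * (2 ^ a * 2 ^ b)) := by
    push_cast
    ring
  obtain ⟨hlo, hhi⟩ := abs_le.mp hS
  apply Int.bmod_eq_of_le_mul_two <;> rw [hM] <;> linarith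
end
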